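/- arXiv:1106.5704 — 2 statements merged into one kernel-verified Lean document; each statement's English description precedes it below -/
import Mathlib

section
/- Let X be a finite connected simple graph and let G be a subgroup of the automorphism group of X that acts transitively on the vertex set and transitively on the edge set of X, but not transitively on the set of arcs (ordered pairs of adjacent vertices) of X. Then the degree of every vertex of X is even (and in particular X is regular, all vertices having the same degree). -/
/-- If a subgroup `G` of the automorphism group of a finite connected simple graph `X`
acts transitively on vertices and on edges, but not on arcs (ordered pairs of adjacent
vertices), then every vertex of `X` has even degree (and in particular `X` is regular,
all vertices having the same degree). -/
theorem half_arc_transitive_even_degree {V : Type*} [Fintype V] (X : SimpleGraph V)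
    [DecidableRel X.Adj] (hconn : X.Connected)
    (G : Subgroup (Equiv.Perm V))
    (hAut : ∀ φ ∈ G, ∀ a b : V, X.Adj (φ a) (φ b) ↔ X.Adj a b)
    (hvert : ∀ a b : V, ∃ φ ∈ G, φ a = b)
    (hedge : ∀ e ∈ X.edgeSet, ∀ e' ∈ X.edgeSet, ∃ φ ∈ G, Sym2.map (⇑φ) e = e')
    (hnotarc : ¬ ∀ a b c d : V, X.Adj a b → X.Adj c d → ∃ φ ∈ G, φ a = c ∧ φ b = d) :
    (∀ v : V, Even (X.degree v)) ∧ (∀ u v : V, X.degree u = X.degree v) := by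
  classical
  push Not at hnotarc
  obtain ⟨a, b, c, d, hab, hcd, hn⟩ := hnotarc
  obtain ⟨R, hR⟩ : ∃ R : V → V → Prop, ∀ x y, R x y ↔ ∃ φ ∈ G, φ a = x ∧ φ b = y :=
    ⟨_, fun _ _ => Iff.rfl⟩
  have hinv : ∀ g ∈ G, ∀ x y, R x y → R (g x) (g y) := by
    intro g hg x y h
    obtain ⟨φ, hφ, rfl, rfl⟩ := (hR _ _).1 h
    exact (hR _ _).2 ⟨g * φ, G.mul_mem hg hφ, rfl, rfl⟩
  have hadj : ∀ x y, R x y → X.Adj x y := by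
    intro x y h
    obtain ⟨φ, hφ, rfl, rfl⟩ := (hR _ _).1 h
    exact (hAut φ hφ a b).2 hab
  have htot : ∀ x y, X.Adj x y → R x y ∨ R y x := by
    intro x y h
    obtain ⟨φ, hφ, e⟩ := hedge s(a, b) hab s(x, y) h
    rw [Sym2.map_mk, Sym2.eq_iff] at e
    rcases e with ⟨h1, h2⟩ | ⟨h1, h2⟩
    · exact Or.inl ((hR _ _).2 ⟨φ, hφ, h1, h2⟩)
    · exact Or.inr ((hR _ _).2 ⟨φ, hφ, h1, h2⟩)
  have hncd : ¬ R c d := by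
    intro h
    obtain ⟨φ, hφ, h1, h2⟩ := (hR _ _).1 h
    exact hn φ hφ h1 h2
  have hdc : R d c := (htot c d hcd).resolve_left hncd
  have hanti : ∀ x y, R x y → ¬ R y x := by
    intro x y h h'
    obtain ⟨φ, hφ, h1, h2⟩ := (hR _ _).1 h
    obtain ⟨ψ, hψ, h3, h4⟩ := (hR _ _).1 h'
    obtain ⟨θ, hθ, h5, h6⟩ := (hR _ _).1 hdc
    apply hncd
    refine (hR _ _).2 ⟨θ * (φ⁻¹ * ψ), G.mul_mem hθ (G.mul_mem (G.inv_mem hφ) hψ), ?_, ?_⟩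
    · rw [Equiv.Perm.mul_apply, Equiv.Perm.mul_apply, h3, ← h2, Equiv.Perm.inv_def, Equiv.symm_apply_apply, h6]
    · rw [Equiv.Perm.mul_apply, Equiv.Perm.mul_apply, h4, ← h1, Equiv.Perm.inv_def, Equiv.symm_apply_apply, h5]
  have ole : ∀ u v, (Finset.univ.filter fun w => R u w).card ≤
      (Finset.univ.filter fun w => R v w).card := by
    intro u v
    obtain ⟨g, hg, rfl⟩ := hvert u v
    refine Finset.card_le_card_of_injOn g ?_ g.injective.injOn
    intro w hw
    simp only [Finset.coe_filter, Finset.mem_univ, true_and, Set.mem_ofPred_eq] at hw ⊢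
    exact hinv g hg _ _ hw
  have ile : ∀ u v, (Finset.univ.filter fun w => R w u).card ≤
      (Finset.univ.filter fun w => R w v).card := by
    intro u v
    obtain ⟨g, hg, rfl⟩ := hvert u v
    refine Finset.card_le_card_of_injOn g ?_ g.injective.injOn
    intro w hw
    simp only [Finset.coe_filter, Finset.mem_univ, true_and, Set.mem_ofPred_eq] at hw ⊢
    exact hinv g hg _ _ hw
  have hsum : ∑ v : V, (Finset.univ.filter fun w => R v w).card =
      ∑ v : V, (Finset.univ.filter fun w => R w v).card :=
    Finset.sum_card_bipartiteAbove_eq_sum_card_bipartiteBelow R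
  have heq : (Finset.univ.filter fun w => R a w).card =
      (Finset.univ.filter fun w => R w a).card := by
    rw [Finset.sum_congr rfl (fun v _ => le_antisymm (ole v a) (ole a v)),
      Finset.sum_congr rfl (fun v _ => le_antisymm (ile v a) (ile a v))] at hsum
    simp only [Finset.sum_const, smul_eq_mul] at hsum
    exact Nat.eq_of_mul_eq_mul_left (Finset.card_pos.2 ⟨a, Finset.mem_univ a⟩) hsum
  have hdeg : ∀ v, X.degree v = (Finset.univ.filter fun w => R a w).card +
      (Finset.univ.filter fun w => R a w).card := by
    intro v
    have h1 : X.neighborFinset v =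
        (Finset.univ.filter fun w => R v w) ∪ (Finset.univ.filter fun w => R w v) := by
      ext w
      simp only [SimpleGraph.mem_neighborFinset, Finset.mem_union, Finset.mem_filter,
        Finset.mem_univ, true_and]
      exact ⟨htot v w, fun h => h.elim (hadj v w) (fun h => (hadj w v h).symm)⟩
    rw [← SimpleGraph.card_neighborFinset_eq_degree, h1, Finset.card_union_of_disjoint,
      le_antisymm (ole v a) (ole a v), le_antisymm (ile v a) (ile a v), ← heq]
    rw [Finset.disjoint_left]
    intro w hw hw'
    simp only [Finset.mem_filter, Finset.mem_univ, true_and] at hw hw'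
    exact hanti _ _ hw hw'
  exact ⟨fun v => ⟨_, hdeg v⟩, fun u v => (hdeg u).trans (hdeg v).symm⟩
end

section
/- Let X be a connected simple graph with a 2-coloring c : V → Bool such that adjacent vertices receive different colors, and let G be a subgroup of the color-preserving automorphism group Aut_o(X) acting transitively on the edge set of X. If b and w are adjacent vertices of X, then the stabilizers Stab_G(b) and Stab_G(w) together generate G. -/
/-- Let `X` be a connected simple graph with a proper 2-coloring `c : V → Bool`, and
let `G` be a subgroup of the color-preserving automorphism group of `X` acting
transitively on the edge set of `X`.  If `b` and `w` are adjacent vertices of `X`,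
then the stabilizers `Stab_G(b)` and `Stab_G(w)` together generate `G`. -/
theorem stabilizers_of_adjacent_generate {V : Type*} (X : SimpleGraph V)
    (hconn : X.Connected)
    (c : V → Bool) (hc : ∀ a b : V, X.Adj a b → c a ≠ c b)
    (G : Subgroup (Equiv.Perm V))
    (hAut : ∀ φ ∈ G, ∀ a b : V, X.Adj (φ a) (φ b) ↔ X.Adj a b)
    (hcol : ∀ φ ∈ G, ∀ v : V, c (φ v) = c v)
    (hedge : ∀ e ∈ X.edgeSet, ∀ e' ∈ X.edgeSet, ∃ φ ∈ G, Sym2.map (⇑φ) e = e')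
    (b w : V) (hbw : X.Adj b w) :
    MulAction.stabilizer (↥G) b ⊔ MulAction.stabilizer (↥G) w = ⊤ := by
  have key : ∀ x y : V, X.Adj x y → c x = c b → ∃ g : G, g • b = x ∧ g • w = y := by
    intro x y hxy hx
    obtain ⟨φ, hφ, h⟩ := hedge s(b, w) hbw s(x, y) hxy
    rw [Sym2.map_mk, Sym2.eq_iff] at h
    rcases h with h | h
    · exact ⟨⟨φ, hφ⟩, h.1, h.2⟩
    · exfalso
      apply hc x y hxy
      rw [hx, ← h.1, hcol φ hφ]
  have hadj : ∀ (g : G) (x y : V), X.Adj x y → X.Adj (g • x) (g • y) :=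
    fun g x y h => (hAut g.1 g.2 x y).2 h
  have hcg : ∀ (g : G) (x : V), c (g • x) = c x := fun g x => hcol g.1 g.2 x
  have hb : MulAction.stabilizer (↥G) b ≤
    MulAction.stabilizer (↥G) b ⊔ MulAction.stabilizer (↥G) w := le_sup_left
  have hw : MulAction.stabilizer (↥G) w ≤
    MulAction.stabilizer (↥G) b ⊔ MulAction.stabilizer (↥G) w := le_sup_right
  generalize MulAction.stabilizer (↥G) b ⊔ MulAction.stabilizer (↥G) w = H at hb hw
  have main : ∀ v : V, ∃ h ∈ H, v = h • b ∨ v = h • w := by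
    intro v
    have hr := hconn.preconnected b v
    rw [SimpleGraph.reachable_iff_reflTransGen] at hr
    induction hr with
    | refl => exact ⟨1, H.one_mem, Or.inl (one_smul _ _).symm⟩
    | @tail v v' _ hvv ih =>
      obtain ⟨h, hH, e | e⟩ := ih
      · have h1 := hadj h⁻¹ _ _ hvv
        rw [e, inv_smul_smul] at h1
        obtain ⟨g, g1, g2⟩ := key _ _ h1 rfl
        refine ⟨h * g, H.mul_mem hH (hb g1), Or.inr ?_⟩
        rw [mul_smul, g2, smul_inv_smul]
      · have h1 := hadj h⁻¹ _ _ hvv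
        rw [e, inv_smul_smul] at h1
        have hcc : c (h⁻¹ • v') = c b := by
          have h2 := hc _ _ h1
          have h3 := hc _ _ hbw
          revert h2 h3
          cases c (h⁻¹ • v') <;> cases c b <;> cases c w <;> simp
        obtain ⟨g, g1, g2⟩ := key _ _ h1.symm hcc
        refine ⟨h * g, H.mul_mem hH (hw g2), Or.inl ?_⟩
        rw [mul_smul, g1, smul_inv_smul]
  rw [eq_top_iff]
  intro g _
  obtain ⟨h, hH, e | e⟩ := main (g • b)
  · have : h⁻¹ * g ∈ H := by
      apply hb
      rw [MulAction.mem_stabilizer_iff, mul_smul, e, inv_smul_smul]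
    simpa using H.mul_mem hH this
  · exfalso
    apply hc _ _ hbw
    rw [← hcg g b, e, hcg]
end
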